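/- arXiv:2412.01777 — 2 statements merged into one kernel-verified Lean document; each statement's English description precedes it below -/
import Mathlib

section
/- The subspace Sp₊(2) := {A ∈ M₂(ℝ) : det A = 1 and det(I − A) > 0} of the space of real 2×2 matrices (with its Euclidean topology) is contractible. -/
namespace Stmt15Aux

noncomputable def rr (s : ℝ) (A : Matrix (Fin 2) (Fin 2) ℝ) : ℝ :=
  Real.sqrt (1 + s ^ 2 * (((A 0 0 - A 1 1) / 2) ^ 2 + ((A 1 0 + A 0 1) / 2) ^ 2))

noncomputable def mm (A : Matrix (Fin 2) (Fin 2) ℝ) : ℝ :=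
  ((A 1 0 - A 0 1) / 2) / (rr 1 A - (A 0 0 + A 1 1) / 2)

noncomputable def aa (s : ℝ) (A : Matrix (Fin 2) (Fin 2) ℝ) : ℝ :=
  rr s A * ((s * mm A) ^ 2 - 1) / ((s * mm A) ^ 2 + 1)

noncomputable def bb (s : ℝ) (A : Matrix (Fin 2) (Fin 2) ℝ) : ℝ :=
  rr s A * (2 * (s * mm A)) / ((s * mm A) ^ 2 + 1)

noncomputable def HH (s : ℝ) (A : Matrix (Fin 2) (Fin 2) ℝ) : Matrix (Fin 2) (Fin 2) ℝ :=
  !![aa s A + s * ((A 0 0 - A 1 1) / 2), s * ((A 1 0 + A 0 1) / 2) - bb s A;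
     s * ((A 1 0 + A 0 1) / 2) + bb s A, aa s A - s * ((A 0 0 - A 1 1) / 2)]

theorem rr_sq (s : ℝ) (A : Matrix (Fin 2) (Fin 2) ℝ) : rr s A ^ 2 =
    1 + s ^ 2 * (((A 0 0 - A 1 1) / 2) ^ 2 + ((A 1 0 + A 0 1) / 2) ^ 2) :=
  Real.sq_sqrt (by positivity)

theorem one_le_rr (s : ℝ) (A : Matrix (Fin 2) (Fin 2) ℝ) : 1 ≤ rr s A := by
  apply Real.one_le_sqrt.2
  have : 0 ≤ s ^ 2 * (((A 0 0 - A 1 1) / 2) ^ 2 + ((A 1 0 + A 0 1) / 2) ^ 2) := by positivity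
  linarith

theorem tr_lt {A : Matrix (Fin 2) (Fin 2) ℝ} (h : A.det = 1 ∧ 0 < (1 - A).det) :
    (A 0 0 + A 1 1) / 2 < 1 := by
  obtain ⟨h1, h2⟩ := h
  simp [Matrix.det_fin_two] at h1 h2
  nlinarith

theorem circ {A : Matrix (Fin 2) (Fin 2) ℝ} (h : A.det = 1 ∧ 0 < (1 - A).det) :
    ((A 0 0 + A 1 1) / 2) ^ 2 + ((A 1 0 - A 0 1) / 2) ^ 2 = rr 1 A ^ 2 := by
  obtain ⟨h1, h2⟩ := h
  rw [Matrix.det_fin_two] at h1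
  rw [rr_sq]
  linear_combination h1

theorem mm_sq {A : Matrix (Fin 2) (Fin 2) ℝ} (h : A.det = 1 ∧ 0 < (1 - A).det) :
    mm A ^ 2 = (rr 1 A + (A 0 0 + A 1 1) / 2) / (rr 1 A - (A 0 0 + A 1 1) / 2) := by
  have h1 := tr_lt h
  have h2 := circ h
  have h3 := one_le_rr 1 A
  have h4 : rr 1 A - (A 0 0 + A 1 1) / 2 ≠ 0 := by linarith
  rw [mm, div_pow, div_eq_div_iff (pow_ne_zero 2 h4) h4]
  linear_combination (rr 1 A - (A 0 0 + A 1 1) / 2) * h2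

theorem aa_one {A : Matrix (Fin 2) (Fin 2) ℝ} (h : A.det = 1 ∧ 0 < (1 - A).det) :
    aa 1 A = (A 0 0 + A 1 1) / 2 := by
  have h1 := tr_lt h
  have h3 := one_le_rr 1 A
  have h4 : 0 < rr 1 A - (A 0 0 + A 1 1) / 2 := by linarith
  have h5 := mm_sq h
  rw [eq_div_iff h4.ne'] at h5
  rw [aa, one_mul, div_eq_iff (by positivity)]
  linear_combination h5

theorem bb_one {A : Matrix (Fin 2) (Fin 2) ℝ} (h : A.det = 1 ∧ 0 < (1 - A).det) :
    bb 1 A = (A 1 0 - A 0 1) / 2 := by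
  have h1 := tr_lt h
  have h3 := one_le_rr 1 A
  have h4 : 0 < rr 1 A - (A 0 0 + A 1 1) / 2 := by linarith
  have h5 := mm_sq h
  have h6 : mm A * (rr 1 A - (A 0 0 + A 1 1) / 2) = (A 1 0 - A 0 1) / 2 :=
    div_mul_cancel₀ _ h4.ne'
  rw [eq_div_iff h4.ne'] at h5
  rw [bb, one_mul, div_eq_iff (by positivity), ← h6]
  linear_combination -mm A * h5

theorem HH_one {A : Matrix (Fin 2) (Fin 2) ℝ} (h : A.det = 1 ∧ 0 < (1 - A).det) :
    HH 1 A = A := by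
  rw [HH, aa_one h, bb_one h]
  ext i j
  fin_cases i <;> fin_cases j <;> simp <;> ring

theorem HH_zero (A : Matrix (Fin 2) (Fin 2) ℝ) : HH 0 A = !![-1, 0; 0, -1] := by
  simp [HH, aa, bb, rr]

theorem rr_mono {s : ℝ} (h0 : 0 ≤ s) (h1 : s ≤ 1) (A : Matrix (Fin 2) (Fin 2) ℝ) :
    rr s A ≤ rr 1 A := by
  unfold rr
  gcongr

theorem HH_mem {s : ℝ} (h0 : 0 ≤ s) (h1 : s ≤ 1) {A : Matrix (Fin 2) (Fin 2) ℝ}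
    (h : A.det = 1 ∧ 0 < (1 - A).det) : (HH s A).det = 1 ∧ 0 < (1 - HH s A).det := by
  have hc : aa s A ^ 2 + bb s A ^ 2 = rr s A ^ 2 := by
    have : (s * mm A) ^ 2 + 1 ≠ 0 := by positivity
    unfold aa bb
    field_simp
    ring
  have hd : (HH s A).det = 1 := by
    rw [rr_sq] at hc
    simp only [HH, Matrix.det_fin_two_of]
    linear_combination hc
  refine ⟨hd, ?_⟩
  have ha : aa s A < 1 := by
    have e1 := aa_one h
    have e2 := tr_lt h
    rw [← e1, aa, one_mul, div_lt_one (by positivity)] at e2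
    rw [aa, div_lt_one (by positivity)]
    have r1 := one_le_rr s A
    have r2 := rr_mono h0 h1 A
    have m1 : (s * mm A) ^ 2 ≤ mm A ^ 2 := by
      rw [mul_pow]
      have : s ^ 2 ≤ 1 := by nlinarith
      nlinarith [sq_nonneg (mm A)]
    have k : mm A ^ 2 * (rr s A - 1) < rr s A + 1 := by
      rcases le_total (mm A ^ 2) 1 with q | q
      · nlinarith
      · nlinarith
    nlinarith
  have : (1 - HH s A).det = 1 + (HH s A).det - 2 * aa s A := by
    simp [HH, Matrix.det_fin_two]
    ring
  rw [this, hd]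
  linarith

theorem rr_cont {X : Type*} [TopologicalSpace X] (s : X → ℝ) (A : X → Matrix (Fin 2) (Fin 2) ℝ)
    (hs : Continuous s) (hA : Continuous A) : Continuous fun x => rr (s x) (A x) := by
  have c : ∀ i j, Continuous fun x => A x i j := fun i j => hA.matrix_elem i j
  exact Real.continuous_sqrt.comp (continuous_const.add ((hs.pow 2).mul
    (((((c 0 0).sub (c 1 1)).div_const 2).pow 2).add ((((c 1 0).add (c 0 1)).div_const 2).pow 2))))

theorem HH_cont {X : Type*} [TopologicalSpace X] (s : X → ℝ) (A : X → Matrix (Fin 2) (Fin 2) ℝ)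
    (hs : Continuous s) (hA : Continuous A) (h : ∀ x, (A x).det = 1 ∧ 0 < (1 - A x).det) :
    Continuous fun x => HH (s x) (A x) := by
  have c : ∀ i j, Continuous fun x => A x i j := fun i j => hA.matrix_elem i j
  have cr := rr_cont s A hs hA
  have cr1 := rr_cont (fun _ => 1) A continuous_const hA
  have cm : Continuous fun x => mm (A x) := by
    refine Continuous.div (((c 1 0).sub (c 0 1)).div_const 2)
      (cr1.sub (((c 0 0).add (c 1 1)).div_const 2)) fun x => ?_
    have h1 := tr_lt (h x)
    have h3 := one_le_rr 1 (A x)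
    linarith
  have csm := hs.mul cm
  have ca : Continuous fun x => aa (s x) (A x) :=
    Continuous.div (cr.mul ((csm.pow 2).sub continuous_const))
      ((csm.pow 2).add continuous_const) fun x => by positivity
  have cb : Continuous fun x => bb (s x) (A x) :=
    Continuous.div (cr.mul (continuous_const.mul csm))
      ((csm.pow 2).add continuous_const) fun x => by positivity
  have cc := hs.mul (((c 0 0).sub (c 1 1)).div_const 2)
  have cd := hs.mul (((c 1 0).add (c 0 1)).div_const 2)
  refine continuous_matrix fun i j => ?_
  fin_cases i <;> fin_cases j
  · exact ca.add cc
  · exact cd.sub cb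
  · exact cd.add cb
  · exact ca.sub cc

end Stmt15Aux

open Stmt15Aux in
/-- The set `Sp₊(2)` of real symplectic `2×2` matrices `A` (i.e. `det A = 1`) with
`det(I − A) > 0` is contractible. -/
theorem stmt15 :
    ContractibleSpace {A : Matrix (Fin 2) (Fin 2) ℝ // A.det = 1 ∧ 0 < (1 - A).det} := by
  rw [contractible_iff_id_nullhomotopic]
  have hs : ∀ t : unitInterval, 0 ≤ 1 - (t : ℝ) ∧ 1 - (t : ℝ) ≤ 1 := fun t =>
    ⟨by linarith [t.2.2], by linarith [t.2.1]⟩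
  refine ⟨⟨!![-1, 0; 0, -1], by simp [Matrix.det_fin_two]⟩, ⟨⟨⟨fun p =>
    ⟨HH (1 - p.1) p.2.1, HH_mem (hs p.1).1 (hs p.1).2 p.2.2⟩, ?_⟩, ?_, ?_⟩⟩⟩
  · apply Continuous.subtype_mk
    exact HH_cont (fun p : unitInterval ×
      {A : Matrix (Fin 2) (Fin 2) ℝ // A.det = 1 ∧ 0 < (1 - A).det} => 1 - (p.1 : ℝ))
      (fun p => p.2.1) (continuous_const.sub (continuous_subtype_val.comp continuous_fst))
      (continuous_subtype_val.comp continuous_snd) (fun p => p.2.2)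
  · intro A
    apply Subtype.ext
    simpa using HH_one A.2
  · intro A
    apply Subtype.ext
    simpa using HH_zero A.1
end

section
/- The subspace Sp₋(2) := {A ∈ M₂(ℝ) : det A = 1 and det(I − A) < 0} of the space of real 2×2 matrices (with its Euclidean topology) is homotopy equivalent to the circle S¹ = {z ∈ ℂ : |z| = 1}. -/
noncomputable section

namespace SpMinus

abbrev X := {A : Matrix (Fin 2) (Fin 2) ℝ // A.det = 1 ∧ (1 - A).det < 0}
abbrev C := Metric.sphere (0 : ℂ) 1

def R (p s : ℝ) : ℝ := Real.sqrt (p ^ 2 + s ^ 2 - 1)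

def F (p s : ℝ) (z : ℂ) : Matrix (Fin 2) (Fin 2) ℝ :=
  !![p + R p s * z.re, R p s * z.im + s; R p s * z.im - s, p - R p s * z.re]

theorem C_sq (z : C) : (z : ℂ).re ^ 2 + (z : ℂ).im ^ 2 = 1 := by
  have h : ‖(z : ℂ)‖ = 1 := by simpa using z.2
  have h2 := Complex.sq_norm (z : ℂ)
  rw [h, Complex.normSq_apply] at h2
  linarith

theorem F_mem (p s : ℝ) (z : C) (hp : 1 < p) :
    (F p s z).det = 1 ∧ (1 - F p s z).det < 0 := by
  have hz := C_sq z
  have hR : R p s ^ 2 = p ^ 2 + s ^ 2 - 1 := Real.sq_sqrt (by nlinarith [sq_nonneg s])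
  have h1 : (F p s z).det = 1 := by
    rw [F, Matrix.det_fin_two_of]
    linear_combination (-(R p s)^2) * hz - hR
  refine ⟨h1, ?_⟩
  have : (1 - F p s z).det = 1 + (F p s z).det - 2 * p := by
    simp [F, Matrix.det_fin_two]
    ring
  rw [this, h1]; linarith

def P (A : X) : ℝ := (A.1 0 0 + A.1 1 1) / 2
def S (A : X) : ℝ := (A.1 0 1 - A.1 1 0) / 2
def W (A : X) : ℂ := ⟨(A.1 0 0 - A.1 1 1) / 2, (A.1 0 1 + A.1 1 0) / 2⟩

theorem P_gt (A : X) : 1 < P A := by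
  have h1 := A.2.1
  have h2 := A.2.2
  simp [Matrix.det_fin_two] at h1 h2
  unfold P
  linarith

theorem norm_W (A : X) : ‖W A‖ = R (P A) (S A) := by
  have h1 := A.2.1
  rw [Matrix.det_fin_two] at h1
  rw [Complex.norm_def, R]
  congr 1
  simp only [Complex.normSq_apply, W, P, S]
  linear_combination (-1) * h1

theorem R_pos (p s : ℝ) (hp : 1 < p) : 0 < R p s :=
  Real.sqrt_pos.2 (by nlinarith [sq_nonneg s])

theorem W_pos (A : X) : 0 < ‖W A‖ := by
  rw [norm_W]; exact R_pos _ _ (P_gt A)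

theorem cont_E (i j : Fin 2) : Continuous (fun A : X => A.1 i j) :=
  continuous_subtype_val.matrix_elem i j

theorem cont_W : Continuous W := by
  have : W = fun A => ((((A.1 0 0 - A.1 1 1) / 2 : ℝ) : ℂ)
      + (((A.1 0 1 + A.1 1 0) / 2 : ℝ) : ℂ) * Complex.I) := by
    funext A
    apply Complex.ext <;> simp [W]
  rw [this]
  exact (Complex.continuous_ofReal.comp (((cont_E 0 0).sub (cont_E 1 1)).div_const 2)).add
    ((Complex.continuous_ofReal.comp (((cont_E 0 1).add (cont_E 1 0)).div_const 2)).mul_const _)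

theorem cont_P : Continuous P := ((cont_E 0 0).add (cont_E 1 1)).div_const 2
theorem cont_S : Continuous S := ((cont_E 0 1).sub (cont_E 1 0)).div_const 2

theorem cont_F : Continuous (fun x : ℝ × ℝ × ℂ => F x.1 x.2.1 x.2.2) := by
  unfold F R
  apply continuous_matrix
  intro i j
  fin_cases i <;> fin_cases j <;> simp <;> fun_prop

def U (A : X) : C := ⟨((‖W A‖⁻¹ : ℝ) : ℂ) * W A, by
  simp [(W_pos A).ne']⟩

theorem cont_U : Continuous U := by
  apply Continuous.subtype_mk
  exact (Complex.continuous_ofReal.comp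
    (cont_W.norm.inv₀ fun A => (W_pos A).ne')).mul cont_W

theorem F_U (A : X) : F (P A) (S A) (U A) = A.1 := by
  have h := (W_pos A).ne'
  have hre : ‖W A‖ * (U A : ℂ).re = (A.1 0 0 - A.1 1 1) / 2 := by
    simp only [U, Complex.re_ofReal_mul]
    rw [mul_inv_cancel_left₀ h]; rfl
  have him : ‖W A‖ * (U A : ℂ).im = (A.1 0 1 + A.1 1 0) / 2 := by
    simp only [U, Complex.im_ofReal_mul]
    rw [mul_inv_cancel_left₀ h]; rfl
  unfold F
  rw [← norm_W, hre, him]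
  ext i j
  fin_cases i <;> fin_cases j <;> simp [P, S] <;> ring

def G (z : C) : X := ⟨F 2 0 z, F_mem 2 0 z (by norm_num)⟩

theorem cont_G : Continuous G := by
  apply Continuous.subtype_mk
  exact cont_F.comp (f := fun z : C => ((2 : ℝ), (0 : ℝ), (z : ℂ))) (by fun_prop)

theorem U_G (z : C) : U (G z) = z := by
  have hP : P (G z) = 2 := by simp [P, G, F]
  have hS : S (G z) = 0 := by simp [S, G, F]
  have hW : W (G z) = (R 2 0 : ℂ) * z := by
    apply Complex.ext <;> simp [W, G, F]
  have hR := (R_pos 2 0 (by norm_num)).ne'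
  apply Subtype.ext
  change ((‖W (G z)‖⁻¹ : ℝ) : ℂ) * W (G z) = z
  rw [norm_W, hP, hS, hW, ← mul_assoc, ← Complex.ofReal_mul, inv_mul_cancel₀ hR]
  simp

theorem H_gt (t : unitInterval) (A : X) : 1 < (1 - (t : ℝ)) * 2 + t * P A := by
  have h := P_gt A
  have h0 := t.2.1
  have h1 := t.2.2
  nlinarith [mul_nonneg h0 (sub_pos.2 h).le, mul_nonneg h0 (sub_nonneg.2 h1),
    mul_pos (sub_pos.2 h) (sub_pos.2 h), lt_or_ge (0:ℝ) t |>.elim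
      (fun k => (mul_pos k (sub_pos.2 h)).le) (fun k => (mul_nonneg h0 (sub_pos.2 h).le))]

def H : ContinuousMap.Homotopy
    ((⟨G, cont_G⟩ : C(C, X)).comp (⟨U, cont_U⟩ : C(X, C))) (ContinuousMap.id X) where
  toFun x := ⟨F ((1 - (x.1 : ℝ)) * 2 + x.1 * P x.2) (x.1 * S x.2) (U x.2),
    F_mem _ _ _ (H_gt x.1 x.2)⟩
  continuous_toFun := by
    apply Continuous.subtype_mk
    have hp : Continuous fun x : unitInterval × X => P x.2 := cont_P.comp continuous_snd
    have hs : Continuous fun x : unitInterval × X => S x.2 := cont_S.comp continuous_snd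
    have hu : Continuous fun x : unitInterval × X => (U x.2 : ℂ) :=
      continuous_subtype_val.comp (cont_U.comp continuous_snd)
    have ht : Continuous fun x : unitInterval × X => (x.1 : ℝ) :=
      continuous_subtype_val.comp continuous_fst
    exact cont_F.comp (f := fun x : unitInterval × X =>
      ((1 - (x.1 : ℝ)) * 2 + x.1 * P x.2, x.1 * S x.2, (U x.2 : ℂ)))
      ((((continuous_const.sub ht).mul_const 2).add (ht.mul hp)).prodMk
        ((ht.mul hs).prodMk hu))
  map_zero_left A := by
    apply Subtype.ext
    simp [G]
  map_one_left A := by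
    apply Subtype.ext
    simp [F_U]

end SpMinus

end

/-- The set `Sp₋(2)` of real symplectic `2×2` matrices `A` (i.e. `det A = 1`) with
`det(I − A) < 0` is homotopy equivalent to the circle `S¹ = {z ∈ ℂ : |z| = 1}`. -/
theorem stmt16 :
    Nonempty (ContinuousMap.HomotopyEquiv
      {A : Matrix (Fin 2) (Fin 2) ℝ // A.det = 1 ∧ (1 - A).det < 0}
      (Metric.sphere (0 : ℂ) 1)) := by
  refine ⟨⟨⟨SpMinus.U, SpMinus.cont_U⟩, ⟨SpMinus.G, SpMinus.cont_G⟩, ⟨SpMinus.H⟩, ?_⟩⟩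
  have : (⟨SpMinus.U, SpMinus.cont_U⟩ : C(SpMinus.X, SpMinus.C)).comp
      ⟨SpMinus.G, SpMinus.cont_G⟩ = ContinuousMap.id _ := by
    ext1 z
    exact SpMinus.U_G z
  rw [this]
end
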